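/- Let d ≥ 2, let μ be the Haar probability measure on U(d), let O be a d×d Hermitian matrix, and let ρ be a pure-state density matrix (positive semidefinite, Tr[ρ] = 1, ρ² = ρ). Then the variance of the cost function V ↦ Tr[O V ρ V†] under the Haar measure equals ∫ (Tr[O V ρ V†])² dμ(V) − (∫ Tr[O V ρ V†] dμ(V))² = ((Tr[O])² + Tr[O²])/(d² − 1) · (1 − 1/d) − (Tr[O])²/d². -/

import Mathlib

open MeasureTheory Matrix
open scoped Kronecker ComplexOrder

noncomputable section

attribute [local instance] Matrix.frobeniusNormedAddCommGroup Matrix.frobeniusNormedSpace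

local instance {n m : Type*} [Fintype n] [Fintype m] : MeasurableSpace (Matrix n m ℂ) :=
  borel _

local instance {n m : Type*} [Fintype n] [Fintype m] : BorelSpace (Matrix n m ℂ) := ⟨rfl⟩

/-- The Frobenius (Hilbert–Schmidt) norm `‖M‖₂ = √Tr[M† M]`. -/
def frobNorm {n : Type*} [Fintype n] (M : Matrix n n ℂ) : ℝ :=
  Real.sqrt (Matrix.trace (star M * M)).re

instance compactUnitary (d : ℕ) : CompactSpace (Matrix.unitaryGroup (Fin d) ℂ) := by
  apply isCompact_iff_compactSpace.mp
  have hc : IsCompact {M : Matrix (Fin d) (Fin d) ℂ | ∀ i, M i ∈ {v : Fin d → ℂ | ∀ j, v j ∈ Metric.closedBall (0 : ℂ) 1}} :=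
    isCompact_pi_infinite (fun i => isCompact_pi_infinite (fun j => isCompact_closedBall (0 : ℂ) 1))
  refine hc.of_isClosed_subset (isClosed_unitary (R := Matrix (Fin d) (Fin d) ℂ)) ?_
  intro U hU i j
  simpa using entry_norm_bound_of_unitary hU i j

lemma integrable_of_cont {d : ℕ} (μ : Measure (Matrix.unitaryGroup (Fin d) ℂ))
    [IsProbabilityMeasure μ] {f : Matrix.unitaryGroup (Fin d) ℂ → ℂ} (hf : Continuous f) :
    Integrable f μ :=
  hf.integrable_of_hasCompactSupport (HasCompactSupport.of_compactSpace f)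

lemma integral_add_four {d : ℕ} (μ : Measure (Matrix.unitaryGroup (Fin d) ℂ))
    {f g h k : Matrix.unitaryGroup (Fin d) ℂ → ℂ} (hf : Integrable f μ) (hg : Integrable g μ)
    (hh : Integrable h μ) (hk : Integrable k μ) :
    ∫ V, (((f V + g V) + h V) + k V) ∂μ
      = ∫ V, f V ∂μ + ∫ V, g V ∂μ + ∫ V, h V ∂μ + ∫ V, k V ∂μ := by
  have h1 := integral_add ((hf.add hg).add hh) hk
  have h2 := integral_add (hf.add hg) hh
  have h3 := integral_add hf hg
  simp only [Pi.add_apply] at h1 h2 h3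
  rw [h1, h2, h3]

lemma haar_inv {d : ℕ} (μ : Measure (Matrix.unitaryGroup (Fin d) ℂ))
    [μ.IsHaarMeasure] (ρ : Matrix (Fin d) (Fin d) ℂ)
    (W : Matrix (Fin d) (Fin d) ℂ) (hW : W ∈ Matrix.unitaryGroup (Fin d) ℂ)
    (F : Matrix (Fin d) (Fin d) ℂ → ℂ) :
    ∫ V : Matrix.unitaryGroup (Fin d) ℂ, F (W * (V.1 * ρ * star V.1) * star W) ∂μ
      = ∫ V : Matrix.unitaryGroup (Fin d) ℂ, F (V.1 * ρ * star V.1) ∂μ := by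
  rw [← integral_mul_left_eq_self (μ := μ) (fun V : Matrix.unitaryGroup (Fin d) ℂ =>
    F (V.1 * ρ * star V.1)) ⟨W, hW⟩]
  congr 1
  ext V
  congr 1
  simp [mul_assoc]

lemma pure_rank_one {d : ℕ} (ρ : Matrix (Fin d) (Fin d) ℂ) (hρ : ρ.IsHermitian)
    (hρ1 : ρ.trace = 1) (hρ2 : ρ * ρ = ρ) :
    ∃ u w : Fin d → ℂ, ρ = vecMulVec u w := by
  obtain ⟨k, hk⟩ : ∃ k, ρ k k ≠ 0 := by
    by_contra! h
    simp [Matrix.trace, h] at hρ1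
  set E : Matrix (Fin d) (Fin d) ℂ := Matrix.single k k 1 with hE
  set c := ρ k k with hc
  have hEE : E * ρ * E = c • E := by
    ext i j
    simp [hE, Matrix.single, Matrix.mul_apply, Matrix.smul_apply, hc, ite_and]
    grind
  have hEh : Eᴴ = E := by simp [hE]
  have hcc : star c = c := hρ.apply k k
  set Q := ρ - c⁻¹ • (ρ * E * ρ) with hQ
  have hQh : Qᴴ = Q := by
    rw [hQ, conjTranspose_sub, conjTranspose_smul, conjTranspose_mul, conjTranspose_mul, hEh,
      hρ.eq, star_inv₀, hcc, Matrix.mul_assoc]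
  have h1 : ρ * (ρ * E * ρ) = ρ * E * ρ := by
    rw [← Matrix.mul_assoc, ← Matrix.mul_assoc, hρ2]
  have h2 : (ρ * E * ρ) * ρ = ρ * E * ρ := by
    rw [Matrix.mul_assoc, hρ2]
  have h3 : (ρ * E * ρ) * (ρ * E * ρ) = c • (ρ * E * ρ) := by
    calc (ρ * E * ρ) * (ρ * E * ρ) = ρ * (E * (ρ * ρ) * E) * ρ := by noncomm_ring
      _ = _ := by rw [hρ2, hEE]; simp
  have hQQ : Q * Q = Q := by
    rw [hQ, sub_mul, mul_sub, mul_sub, hρ2, mul_smul_comm, smul_mul_assoc, smul_mul_assoc,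
      mul_smul_comm, h1, h2, h3, smul_smul c⁻¹ c, inv_mul_cancel₀ hk, one_smul]
    simp
  have htr : (ρ * E * ρ).trace = c := by
    rw [Matrix.trace_mul_comm, ← Matrix.mul_assoc, hρ2]
    simp [hE, Matrix.trace_mul_single, hc]
  have hQt : Q.trace = 0 := by
    rw [hQ, trace_sub, trace_smul, htr, hρ1]
    simp [hk]
  have hQ0 : Q = 0 := by
    rw [← trace_conjTranspose_mul_self_eq_zero_iff, hQh, hQQ, hQt]
  refine ⟨fun i => c⁻¹ * ρ i k, fun j => ρ k j, ?_⟩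
  ext i j
  have := congrFun (congrFun (sub_eq_zero.mp hQ0) i) j
  rw [this]
  simp [vecMulVec_apply, Matrix.mul_apply, hE, Matrix.single, ite_and, mul_assoc]

lemma minor_zero {d : ℕ} (ρ : Matrix (Fin d) (Fin d) ℂ) (hρ : ρ.IsHermitian)
    (hρ1 : ρ.trace = 1) (hρ2 : ρ * ρ = ρ) (V : Matrix (Fin d) (Fin d) ℂ) (i j : Fin d) :
    (V * ρ * star V) i j * (V * ρ * star V) j i
      = (V * ρ * star V) i i * (V * ρ * star V) j j := by
  obtain ⟨u, w, rfl⟩ := pure_rank_one ρ hρ hρ1 hρ2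
  rw [mul_vecMulVec, vecMulVec_mul]
  simp only [vecMulVec_apply]
  ring

lemma rot_mem {d : ℕ} (i j : Fin d) :
    ((1 + Complex.I) / 2) • (1 : Matrix (Fin d) (Fin d) ℂ)
      + ((1 - Complex.I) / 2) • (Equiv.swap i j).permMatrix ℂ ∈ Matrix.unitaryGroup (Fin d) ℂ := by
  have hS : (Equiv.swap i j).permMatrix ℂ * (Equiv.swap i j).permMatrix ℂ = 1 := by
    rw [← permMatrix_mul]; simp
  rw [mem_unitaryGroup_iff, star_eq_conjTranspose]
  simp only [conjTranspose_add, conjTranspose_smul, conjTranspose_one, conjTranspose_permMatrix,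
    Equiv.swap_inv, add_mul, mul_add, smul_mul_assoc, mul_smul_comm, hS, one_mul, mul_one]
  ext a b
  simp only [Matrix.add_apply, Matrix.smul_apply, smul_eq_mul]
  generalize (Equiv.swap i j).permMatrix ℂ a b = s
  generalize (1 : Matrix (Fin d) (Fin d) ℂ) a b = t
  simp
  ring_nf
  simp
  ring

lemma swap_mem {d : ℕ} (i j : Fin d) :
    (Equiv.swap i j).permMatrix ℂ ∈ Matrix.unitaryGroup (Fin d) ℂ := by
  rw [mem_unitaryGroup_iff, star_eq_conjTranspose, conjTranspose_permMatrix, ← permMatrix_mul]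
  simp

lemma swap_conj {d : ℕ} (i j : Fin d) (X : Matrix (Fin d) (Fin d) ℂ) :
    ((Equiv.swap i j).permMatrix ℂ * X * star ((Equiv.swap i j).permMatrix ℂ)) i i = X j j := by
  rw [star_eq_conjTranspose, conjTranspose_permMatrix, Equiv.swap_inv, Equiv.Perm.permMatrix,
    PEquiv.toMatrix_toPEquiv_mul, PEquiv.mul_toMatrix_toPEquiv]
  simp

lemma rot_conj {d : ℕ} (i j : Fin d) (X : Matrix (Fin d) (Fin d) ℂ) 
    (W : Matrix (Fin d) (Fin d) ℂ) (hW : W = ((1 + Complex.I) / 2) • (1 : Matrix (Fin d) (Fin d) ℂ)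
      + ((1 - Complex.I) / 2) • (Equiv.swap i j).permMatrix ℂ) :
    (W * X * star W) i i = (X i i + X j j + Complex.I * (X i j - X j i)) / 2 ∧
    (W * X * star W) j j = (X i i + X j j - Complex.I * (X i j - X j i)) / 2 := by
  subst hW
  rw [star_eq_conjTranspose]
  simp only [conjTranspose_add, conjTranspose_smul, conjTranspose_one, conjTranspose_permMatrix,
    Equiv.swap_inv, add_mul, mul_add, smul_mul_assoc, mul_smul_comm, one_mul, mul_one, 
    Equiv.Perm.permMatrix, PEquiv.toMatrix_toPEquiv_mul, PEquiv.mul_toMatrix_toPEquiv]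
  simp only [Matrix.add_apply, Matrix.smul_apply, smul_eq_mul]
  constructor <;> simp <;> ring_nf <;> simp <;> ring

lemma phase_mem {d : ℕ} (i : Fin d) :
    diagonal (fun k => if k = i then Complex.I else 1) ∈ Matrix.unitaryGroup (Fin d) ℂ := by
  rw [mem_unitaryGroup_iff, star_eq_conjTranspose, diagonal_conjTranspose, diagonal_mul_diagonal,
    ← diagonal_one]
  congr 1
  ext k
  simp
  split_ifs <;> simp

lemma phase_conj {d : ℕ} (i j : Fin d) (hij : i ≠ j) (X : Matrix (Fin d) (Fin d) ℂ)
    (W : Matrix (Fin d) (Fin d) ℂ) (hW : W = diagonal (fun k => if k = i then Complex.I else 1)) :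
    (W * X * star W) i j = Complex.I * X i j ∧ (W * X * star W) j i = -Complex.I * X j i := by
  subst hW
  rw [star_eq_conjTranspose, diagonal_conjTranspose]
  simp only [mul_diagonal, diagonal_mul]
  simp [hij.symm, mul_comm]

lemma haar_moment {d : ℕ} (hd : 2 ≤ d) (μ : Measure (Matrix.unitaryGroup (Fin d) ℂ))
    [μ.IsHaarMeasure] [IsProbabilityMeasure μ]
    (ρ : Matrix (Fin d) (Fin d) ℂ) (hρ : ρ.IsHermitian)
    (hρ1 : ρ.trace = 1) (hρ2 : ρ * ρ = ρ) (i j : Fin d) :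
    ∫ V : Matrix.unitaryGroup (Fin d) ℂ,
      (V.1 * ρ * star V.1) i i * (V.1 * ρ * star V.1) j j ∂μ
      = (1 + if i = j then 1 else 0) / ((d : ℂ) * (d + 1)) := by
  have hint : ∀ a b k l : Fin d, Integrable (fun V : Matrix.unitaryGroup (Fin d) ℂ =>
      (V.1 * ρ * star V.1) a b * (V.1 * ρ * star V.1) k l) μ := fun a b k l =>
    integrable_of_cont μ (by fun_prop)
  set m : Fin d → Fin d → ℂ := fun i j => ∫ V : Matrix.unitaryGroup (Fin d) ℂ,
      (V.1 * ρ * star V.1) i i * (V.1 * ρ * star V.1) j j ∂μ with hm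
  have hdiag : ∀ i j, m i i = m j j := by
    intro i j
    have := haar_inv μ ρ _ (swap_mem i j) (fun X => X i i * X i i)
    simp only [swap_conj] at this
    exact this.symm
  have hph : ∀ i j, i ≠ j → ∫ V : Matrix.unitaryGroup (Fin d) ℂ,
      (V.1 * ρ * star V.1) i j * (V.1 * ρ * star V.1) i j ∂μ = 0 := by
    intro i j hij
    have := haar_inv μ ρ _ (phase_mem i) (fun X => X i j * X i j)
    simp only [(phase_conj i j hij _ _ rfl).1] at this
    have h2 : ∀ x : ℂ, Complex.I * x * (Complex.I * x) = - (x * x) := by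
      intro x
      linear_combination (x * x) * Complex.I_mul_I
    simp only [h2, integral_neg] at this
    exact CharZero.neg_eq_self_iff.mp this
  have hoff : ∀ i j, i ≠ j → 4 * m i j = m i i + m j j := by
    intro i j hij
    have := haar_inv μ ρ _ (rot_mem i j) (fun X => X i i * X j j)
    simp only [(rot_conj i j _ _ rfl).1, (rot_conj i j _ _ rfl).2] at this
    have h2 : ∀ V : Matrix.unitaryGroup (Fin d) ℂ,
        ((V.1 * ρ * star V.1) i i + (V.1 * ρ * star V.1) j j
          + Complex.I * ((V.1 * ρ * star V.1) i j - (V.1 * ρ * star V.1) j i)) / 2 *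
        (((V.1 * ρ * star V.1) i i + (V.1 * ρ * star V.1) j j
          - Complex.I * ((V.1 * ρ * star V.1) i j - (V.1 * ρ * star V.1) j i)) / 2)
        = ((((V.1 * ρ * star V.1) i i * (V.1 * ρ * star V.1) i i
          + (V.1 * ρ * star V.1) j j * (V.1 * ρ * star V.1) j j)
          + (V.1 * ρ * star V.1) i j * (V.1 * ρ * star V.1) i j)
          + (V.1 * ρ * star V.1) j i * (V.1 * ρ * star V.1) j i) / 4 := by
      intro V
      have h3 := minor_zero ρ hρ hρ1 hρ2 V.1 i j
      linear_combination (-1/2) * h3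
        - (((V.1 * ρ * star V.1) i j - (V.1 * ρ * star V.1) j i)^2/4) * Complex.I_mul_I
    simp only [h2] at this
    rw [integral_div, integral_add_four μ (hint i i i i) (hint j j j j) (hint i j i j)
      (hint j i j i), hph i j hij, hph j i hij.symm] at this
    change (m i i + m j j + 0 + 0) / 4 = m i j at this
    rw [← this]
    ring
  have htr : ∀ V : Matrix.unitaryGroup (Fin d) ℂ, ∑ i, (V.1 * ρ * star V.1) i i = 1 := by
    intro V
    change (V.1 * ρ * star V.1).trace = 1
    rw [Matrix.trace_mul_comm, ← Matrix.mul_assoc, mem_unitaryGroup_iff'.mp V.2, Matrix.one_mul, hρ1]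
  have hsum : ∑ i, ∑ j, m i j = 1 := by
    have h1 : ∀ V : Matrix.unitaryGroup (Fin d) ℂ,
      ∑ i, ∑ j, (V.1 * ρ * star V.1) i i * (V.1 * ρ * star V.1) j j = 1 := by
      intro V
      rw [← Finset.sum_mul_sum, htr, one_mul]
    have h2 : ∫ V : Matrix.unitaryGroup (Fin d) ℂ, 
        ∑ i, ∑ j, (V.1 * ρ * star V.1) i i * (V.1 * ρ * star V.1) j j ∂μ = 1 := by
      simp only [h1]
      simp
    rw [integral_finsetSum _ (fun i _ => integrable_finsetSum _ (fun j _ => hint _ _ _ _))] at h2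
    simp only [integral_finsetSum _ (fun j _ => hint _ _ _ _)] at h2
    exact h2
  obtain ⟨a, hall⟩ : ∃ a : ℂ, ∀ k l, m k l = a * (1 + if k = l then 1 else 0) := by
    refine ⟨m i i / 2, ?_⟩
    intro k l
    split_ifs with h
    · subst h
      rw [hdiag k i]; ring
    · have := hoff k l h
      rw [hdiag k i, hdiag l i] at this
      linear_combination this / 4
  have hd0 : (d : ℂ) ≠ 0 := by
    have : d ≠ 0 := by omega
    exact_mod_cast this
  have hd1 : (d : ℂ) + 1 ≠ 0 := by exact_mod_cast Nat.succ_ne_zero d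
  have ha : a * (d * (d + 1)) = 1 := by
    have h := hsum
    simp_rw [hall] at h
    simp only [← Finset.mul_sum, Finset.sum_add_distrib, Finset.sum_const, Finset.card_univ,
      Fintype.card_fin, nsmul_eq_mul, Finset.sum_ite_eq, Finset.mem_univ, if_true] at h
    linear_combination h
  change m i j = _
  rw [hall i j, eq_div_iff (mul_ne_zero hd0 hd1)]
  linear_combination (1 + if i = j then 1 else 0) * ha

/-- The Haar variance of the cost function `V ↦ Tr[O V ρ V†]`: for `d ≥ 2`, a Hermitian
observable `O` and a pure-state density matrix `ρ`,
`∫ (Tr[O V ρ V†])² dμ(V) − (∫ Tr[O V ρ V†] dμ(V))²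
  = ((Tr[O])² + Tr[O²])/(d² − 1) · (1 − 1/d) − (Tr[O])²/d²`. -/
theorem haar_variance_cost (d : ℕ) (hd : 2 ≤ d)
    (μ : Measure (Matrix.unitaryGroup (Fin d) ℂ))
    [μ.IsHaarMeasure] [IsProbabilityMeasure μ]
    (O : Matrix (Fin d) (Fin d) ℂ) (hO : O.IsHermitian)
    (ρ : Matrix (Fin d) (Fin d) ℂ) (hρ : ρ.PosSemidef)
    (hρ1 : ρ.trace = 1) (hρ2 : ρ * ρ = ρ) :
    (∫ V : Matrix.unitaryGroup (Fin d) ℂ, ((O * (V.1 * ρ * star V.1)).trace) ^ 2 ∂μ)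
        - (∫ V : Matrix.unitaryGroup (Fin d) ℂ, (O * (V.1 * ρ * star V.1)).trace ∂μ) ^ 2
      = ((O.trace) ^ 2 + (O * O).trace) / ((d : ℂ) ^ 2 - 1) * (1 - 1 / (d : ℂ))
        - (O.trace) ^ 2 / (d : ℂ) ^ 2 := by
  have hH := hρ.isHermitian
  have hd0 : (d : ℂ) ≠ 0 := by
    have : d ≠ 0 := by omega
    exact_mod_cast this
  have hd1 : (d : ℂ) + 1 ≠ 0 := by exact_mod_cast Nat.succ_ne_zero d
  have hdm : (d : ℂ) - 1 ≠ 0 := by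
    intro h
    have h' : (d : ℂ) = 1 := sub_eq_zero.mp h
    have : d = 1 := by exact_mod_cast h'
    omega
  have hint : ∀ a b k l : Fin d, Integrable (fun V : Matrix.unitaryGroup (Fin d) ℂ =>
      (V.1 * ρ * star V.1) a b * (V.1 * ρ * star V.1) k l) μ := fun a b k l =>
    integrable_of_cont μ (by fun_prop)
  have hint1 : ∀ a b : Fin d, Integrable (fun V : Matrix.unitaryGroup (Fin d) ℂ =>
      (V.1 * ρ * star V.1) a b) μ := fun a b =>
    integrable_of_cont μ (by fun_prop)
  have htr : ∀ V : Matrix.unitaryGroup (Fin d) ℂ, ∑ i, (V.1 * ρ * star V.1) i i = 1 := by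
    intro V
    change (V.1 * ρ * star V.1).trace = 1
    rw [Matrix.trace_mul_comm, ← Matrix.mul_assoc, mem_unitaryGroup_iff'.mp V.2, Matrix.one_mul, hρ1]
  have hfirst : ∀ i, ∫ V : Matrix.unitaryGroup (Fin d) ℂ, (V.1 * ρ * star V.1) i i ∂μ = 1 / d := by
    intro i
    have h1 : ∀ V : Matrix.unitaryGroup (Fin d) ℂ, (V.1 * ρ * star V.1) i i
        = ∑ j, (V.1 * ρ * star V.1) i i * (V.1 * ρ * star V.1) j j := by
      intro V
      rw [← Finset.mul_sum, htr, mul_one]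
    rw [integral_congr_ae (ae_of_all _ h1), integral_finsetSum _ (fun j _ => hint _ _ _ _)]
    simp_rw [haar_moment hd μ ρ hH hρ1 hρ2]
    rw [← Finset.sum_div]
    simp [Finset.sum_add_distrib]
    field_simp
  set U := hO.eigenvectorUnitary with hU
  set l : Fin d → ℂ := fun i => (hO.eigenvalues i : ℂ) with hl
  have hspec : O = U.1 * diagonal l * star U.1 := by
    have h := hO.spectral_theorem
    rw [Unitary.conjStarAlgAut_apply] at h
    exact h
  have hUU : star U.1 * U.1 = 1 := mem_unitaryGroup_iff'.mp U.2
  have htO : O.trace = ∑ i, l i := by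
    rw [hspec, Matrix.trace_mul_comm, ← Matrix.mul_assoc, hUU, Matrix.one_mul, trace_diagonal]
  have htOO : (O * O).trace = ∑ i, l i * l i := by
    have : O * O = U.1 * (diagonal l * diagonal l) * star U.1 := by
      rw [hspec]
      calc _ = U.1 * diagonal l * (star U.1 * U.1) * diagonal l * star U.1 := by noncomm_ring
        _ = _ := by rw [hUU]; noncomm_ring
    rw [this, Matrix.trace_mul_comm, ← Matrix.mul_assoc, hUU, Matrix.one_mul, diagonal_mul_diagonal,
      trace_diagonal]
  have hcost : ∀ X : Matrix (Fin d) (Fin d) ℂ,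
      (O * X).trace = ∑ i, l i * (star U.1 * X * star (star U.1)) i i := by
    intro X
    have h1 : (O * X).trace = (diagonal l * (star U.1 * X * star (star U.1))).trace := by
      rw [hspec, star_star, Matrix.mul_assoc, Matrix.mul_assoc, Matrix.trace_mul_comm]
      congr 1
      noncomm_ring
    rw [h1]
    simp [Matrix.trace, diagonal_mul]
  have hUs : star U.1 ∈ Matrix.unitaryGroup (Fin d) ℂ := Unitary.star_mem U.2
  have hI1 : ∫ V : Matrix.unitaryGroup (Fin d) ℂ, (O * (V.1 * ρ * star V.1)).trace ∂μ
      = O.trace / d := by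
    simp_rw [hcost]
    rw [haar_inv μ ρ _ hUs (fun X => ∑ i, l i * X i i),
      integral_finsetSum _ (fun i _ => (hint1 i i).const_mul (l i))]
    simp_rw [integral_const_mul, hfirst]
    rw [← Finset.sum_mul, htO]
    ring
  have hI2 : ∫ V : Matrix.unitaryGroup (Fin d) ℂ, ((O * (V.1 * ρ * star V.1)).trace) ^ 2 ∂μ
      = (O.trace ^ 2 + (O * O).trace) / (d * (d + 1)) := by
    rw [htO, htOO]
    simp_rw [hcost]
    rw [haar_inv μ ρ _ hUs (fun X => (∑ i, l i * X i i) ^ 2)]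
    have h1 : ∀ V : Matrix.unitaryGroup (Fin d) ℂ, (∑ i, l i * (V.1 * ρ * star V.1) i i) ^ 2
        = ∑ i, ∑ j, (l i * l j) * ((V.1 * ρ * star V.1) i i * (V.1 * ρ * star V.1) j j) := by
      intro V
      rw [sq, Finset.sum_mul_sum]
      refine Finset.sum_congr rfl fun i _ => Finset.sum_congr rfl fun j _ => ?_
      ring
    simp_rw [h1]
    rw [integral_finsetSum _ (fun i _ => integrable_finsetSum _
      (fun j _ => (hint _ _ _ _).const_mul _))]
    simp_rw [integral_finsetSum _ (fun j _ => (hint _ _ _ _).const_mul _), integral_const_mul,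
      haar_moment hd μ ρ hH hρ1 hρ2, ← mul_div_assoc, ← Finset.sum_div]
    rw [sq, Finset.sum_mul_sum]
    simp [mul_add, Finset.sum_add_distrib]
  rw [hI1, hI2]
  have hdd : (d : ℂ) ^ 2 - 1 = (d - 1) * (d + 1) := by ring
  rw [hdd]
  field_simp
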